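/- arXiv:2601.02193 — 5 statements merged into one kernel-verified Lean document; each statement's English description precedes it below -/
import Mathlib

section
/- There exist constants c, c' > 0 such that for all integers d ≥ 1 and n ≥ c·d the following holds. Set r = ⌈c·n/log(n/d)⌉, let X be the disjoint union of {x_1,…,x_r} and {y_T : T ⊆ {1,…,r}, |T| = d}, and let H consist of the all-zero function h⋆ together with, for each d-element subset T of {1,…,r}, the function h_T with h_T(x_i) = 1 iff i ∈ T and h_T(y_{T'}) = 0 for every T'. Let D be uniform on {x_1,…,x_r}. Define the ERM E: on a labeled sample S, if S contains a point y_T such that S contains no x_i with i ∈ T, output h_T (for the first such y_T in S); otherwise output h⋆. Define the monotone adversary A: given a clean sample C ∈ X^n, if there is a d-element subset T of {1,…,r} with x_i ∉ C for all i ∈ T, output m copies of y_T for the lexicographically smallest such T; otherwise output m copies of x_1. Let t ≥ 1, m = ⌈2n/t⌉, k ≥ 1, and let L_1,…,L_k be arbitrary fixed sequences of indices from {1,…,n+m}, each containing at least t distinct indices. Draw C ∼ D^n, let S be a uniformly random permutation of the n + m points of C and A(C), all labeled by h⋆, let S_i be the labeled subsequence of S given by the indices in L_i, and define the majority vote h_vote(x)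 = 1 iff |{i ∈ {1,…,k} : E(S_i)(x) = 1}| > k/2. Then E[ err_{D,h⋆}(h_vote) ] ≥ d·log(n/d)/(c'·n). -/
open Classical

noncomputable section

/-- The domain: the disjoint union of `{x_1,…,x_r}` (encoded `Sum.inl i`) and
`{y_T : T ⊆ {1,…,r}, |T| = d}` (encoded `Sum.inr T`). -/
abbrev Dom (r d : ℕ) := Fin r ⊕ {T : Finset (Fin r) // T.card = d}

/-- The hypothesis `h_T`, predicting `1` on `x_i` iff `i ∈ T` and `0` on every `y_{T'}`. -/
def hypT {r d : ℕ} (T : {T : Finset (Fin r) // T.card = d}) : Dom r d → Bool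
  | Sum.inl i => decide (i ∈ T.1)
  | Sum.inr _ => false

/-- The adversarial ERM `E`: on a labeled sample `S`, if `S` contains a point `y_T`
such that `S` contains no `x_i` with `i ∈ T`, output `h_T` for the first such `y_T` in
`S`; otherwise output the all-zero hypothesis `h⋆`. -/
def ermE {r d : ℕ} (S : List (Dom r d × Bool)) : Dom r d → Bool :=
  match S.find? (fun p => @decide (∃ T : {T : Finset (Fin r) // T.card = d},
      p.1 = Sum.inr T ∧ ∀ q ∈ S, ∀ i ∈ T.1, q.1 ≠ Sum.inl i)
      (Classical.propDecidable _)) with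
  | some (Sum.inr T, _) => hypT T
  | _ => fun _ => false

/-- The candidate sets for the adversary: `d`-element subsets `T` of `{1,…,r}` with
`x_i ∉ C` for all `i ∈ T`. -/
def cands {r d n : ℕ} (C : Fin n → Fin r) : Finset {T : Finset (Fin r) // T.card = d} :=
  Finset.univ.filter fun T => ∀ i ∈ T.1, ∀ j, C j ≠ i

/-- Encoding of a `d`-subset of `{1,…,r}` as a natural number; among subsets this
encoding is strictly antitone with respect to the lexicographic order, so the
lexicographically smallest candidate set is the one maximizing `encT`. -/
def encT {r d : ℕ} (T : {T : Finset (Fin r) // T.card = d}) : ℕ :=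
  ∑ i ∈ T.1, 2 ^ (r - 1 - (i : ℕ))

/-- The single point the monotone adversary adds (`m` copies of it): `y_T` for the
lexicographically smallest candidate `T` if one exists, and `x_1` otherwise. -/
def advPoint {r d n : ℕ} (hr : 0 < r) (C : Fin n → Fin r) : Dom r d :=
  if h : (cands (d := d) C).Nonempty then
    Sum.inr (((cands (d := d) C).exists_max_image encT h).choose)
  else Sum.inl ⟨0, hr⟩

/-- The shuffled labeled sample of size `n + m`: the `n` clean points `x_{C j}` and `m`
copies of the adversarial point, permuted by `π` and all labeled `0` by the target. -/
def sample {r d n m : ℕ} (hr : 0 < r) (C : Fin n → Fin r)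
    (π : Equiv.Perm (Fin (n + m))) (j : Fin (n + m)) : Dom r d × Bool :=
  (Fin.append (fun a => Sum.inl (C a)) (fun _ => advPoint (d := d) hr C) (π j), false)

/-- The majority vote over the `k` hypotheses produced by running the ERM `E` on the
subsequences of the shuffled sample given by the index lists `L_1, …, L_k`. -/
def vote {r d n m : ℕ} (k : ℕ) (L : Fin k → List (Fin (n + m))) (hr : 0 < r)
    (C : Fin n → Fin r) (π : Equiv.Perm (Fin (n + m))) : Dom r d → Bool :=
  fun x => decide (k < 2 * (Finset.univ.filter fun i : Fin k =>
    ermE ((L i).map (sample (d := d) hr C π)) x = true).card)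

/-- If the only `y`-point in the sample is `y_T`, it occurs, and no `x_i` with `i ∈ T` occurs,
then the ERM outputs `h_T`. -/
theorem ermE_eq_hypT {r d : ℕ} (S : List (Dom r d × Bool))
    (T : {T : Finset (Fin r) // T.card = d}) (hmem : ∃ p ∈ S, p.1 = Sum.inr T)
    (hS : ∀ q ∈ S, q.1 = Sum.inr T ∨ ∃ i, i ∉ T.1 ∧ q.1 = Sum.inl i) :
    ermE S = hypT T := by
  unfold ermE
  have key : ∀ P : Dom r d × Bool → Bool, (∀ p ∈ S, p.1 = Sum.inr T → P p = true) →
      (∀ p ∈ S, P p = true → p.1 = Sum.inr T) →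
      ∃ b, S.find? P = some (Sum.inr T, b) := by
    intro P h1 h2
    obtain ⟨p, hp, hpT⟩ := hmem
    have hs : (S.find? P).isSome := List.find?_isSome.2 ⟨p, hp, h1 p hp hpT⟩
    obtain ⟨⟨q, b⟩, hq⟩ := Option.isSome_iff_exists.1 hs
    have := h2 _ (List.mem_of_find?_eq_some hq) (List.find?_some hq)
    simp only at this
    subst this
    exact ⟨b, hq⟩
  obtain ⟨b, hb⟩ := key (fun p => @decide (∃ T : {T : Finset (Fin r) // T.card = d},
      p.1 = Sum.inr T ∧ ∀ q ∈ S, ∀ i ∈ T.1, q.1 ≠ Sum.inl i)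
      (Classical.propDecidable _)) (by
        intro p hp hpT
        refine @decide_eq_true _ (Classical.propDecidable _) ⟨T, hpT, fun q hq i hi hqi => ?_⟩
        rcases hS q hq with h | ⟨j, hj, h⟩
        · rw [h] at hqi; cases hqi
        · rw [h] at hqi; cases hqi; exact hj hi) (by
        intro p hp hP
        obtain ⟨T', hT', -⟩ := @of_decide_eq_true _ (Classical.propDecidable _) hP
        rcases hS p hp with h | ⟨j, hj, h⟩
        · exact h
        · rw [h] at hT'; cases hT')
  rw [hb]

/-- When a candidate set exists, the adversary plays `y_T` for some candidate `T`. -/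
theorem exists_advPoint_eq {r d n : ℕ} (hr : 0 < r) (C : Fin n → Fin r)
    (h : (cands (d := d) C).Nonempty) :
    ∃ T : {T : Finset (Fin r) // T.card = d},
      (∀ i ∈ T.1, ∀ j, C j ≠ i) ∧ advPoint (d := d) hr C = Sum.inr T := by
  refine ⟨_, ?_, dif_pos h⟩
  have := ((cands (d := d) C).exists_max_image encT h).choose_spec.1
  simpa [cands] using this

/-- Chance that a permutation maps a fixed set `S` into `A`, as a counting bound. -/
theorem card_pow_mul_card_perm_le {α : Type*} [Fintype α] (A S : Finset α) :
    Fintype.card α ^ S.card *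
      (Finset.univ.filter fun π : Equiv.Perm α => ∀ j ∈ S, π j ∈ A).card
      ≤ A.card ^ S.card * (Fintype.card α).factorial := by
  induction S using Finset.induction_on with
  | empty => simp [Fintype.card_perm]
  | insert a S ha ih =>
    set F := Finset.univ.filter fun π : Equiv.Perm α => ∀ j ∈ S, π j ∈ A with hF
    set F' := Finset.univ.filter fun π : Equiv.Perm α => ∀ j ∈ insert a S, π j ∈ A with hF'
    have hle : ∀ j : α, F'.card ≤ (F.filter fun π => π j ∈ A).card := by
      intro j
      by_cases hj : j ∈ S
      · refine Finset.card_le_card fun π hπ => ?_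
        simp only [hF, hF', Finset.mem_filter, Finset.mem_univ, true_and,
          Finset.mem_insert, forall_eq_or_imp] at hπ ⊢
        exact ⟨hπ.2, hπ.2 j hj⟩
      · refine Finset.card_le_card_of_injOn (fun π => π * Equiv.swap a j) ?_
          (fun _ _ _ _ h => mul_right_cancel h)
        intro π hπ
        simp only [hF, hF', Finset.coe_filter, Set.mem_ofPred_eq, Finset.mem_filter,
          Finset.mem_univ, true_and,
          Finset.mem_insert, forall_eq_or_imp, Equiv.Perm.mul_apply] at hπ ⊢
        refine ⟨fun i hi => ?_, by simpa using hπ.1⟩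
        rw [Equiv.swap_apply_of_ne_of_ne (fun h : i = a => ha (h ▸ hi))
          (fun h : i = j => hj (h ▸ hi))]
        exact hπ.2 i hi
    have hsum : ∑ j : α, (F.filter fun π => π j ∈ A).card = A.card * F.card := by
      simp only [Finset.card_filter]
      rw [Finset.sum_comm]
      have : ∀ π ∈ F, (∑ j : α, if π j ∈ A then 1 else 0) = A.card := by
        intro π _
        rw [Equiv.sum_comp π (fun j => if j ∈ A then 1 else 0)]
        simp
      rw [Finset.sum_congr rfl this]
      simp [mul_comm]
    have hstep : Fintype.card α * F'.card ≤ A.card * F.card := by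
      rw [← hsum]
      calc Fintype.card α * F'.card = ∑ _j : α, F'.card := by simp
        _ ≤ _ := Finset.sum_le_sum fun j _ => hle j
    rw [Finset.card_insert_of_notMem ha]
    calc Fintype.card α ^ (S.card + 1) * F'.card
        = Fintype.card α ^ S.card * (Fintype.card α * F'.card) := by ring
      _ ≤ Fintype.card α ^ S.card * (A.card * F.card) := by gcongr
      _ = A.card * (Fintype.card α ^ S.card * F.card) := by ring
      _ ≤ A.card * (A.card ^ S.card * (Fintype.card α).factorial) := by gcongr
      _ = _ := by ring

/-- A set of at least `t` indices misses all `m ≥ 2n/t` inserted points with probability at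
most `1/3`. -/
theorem three_mul_card_miss_le {n m t : ℕ} (hn : 0 < n) (ht : 1 ≤ t)
    (hm : 2 * (n : ℝ) / (t : ℝ) ≤ m) (S : Finset (Fin (n + m))) (hS : t ≤ S.card) :
    3 * ((Finset.univ.filter fun π : Equiv.Perm (Fin (n + m)) =>
      ∀ j ∈ S, π j ∈ Finset.univ.map (Fin.castAddEmb m)).card : ℝ)
      ≤ ((n + m).factorial : ℝ) := by
  set F := (Finset.univ.filter fun π : Equiv.Perm (Fin (n + m)) =>
      ∀ j ∈ S, π j ∈ Finset.univ.map (Fin.castAddEmb m)).card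
  have h : Fintype.card (Fin (n + m)) ^ S.card * F
      ≤ (Finset.univ.map (Fin.castAddEmb (n := n) m)).card ^ S.card
        * (Fintype.card (Fin (n + m))).factorial := by
    convert card_pow_mul_card_perm_le (Finset.univ.map (Fin.castAddEmb (n := n) m)) S
  clear_value F
  rw [Finset.card_map, Finset.card_univ, Fintype.card_fin, Fintype.card_fin] at h
  generalize (n + m).factorial = N at h ⊢
  have h' : ((n : ℝ) + m) ^ S.card * F ≤ (n : ℝ) ^ S.card * N := by
    exact_mod_cast h
  have hn' : (0 : ℝ) < n := by exact_mod_cast hn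
  have ht' : (0 : ℝ) < t := by exact_mod_cast ht
  have hS' : (t : ℝ) ≤ S.card := by exact_mod_cast hS
  have h3 : 3 * (n : ℝ) ^ S.card ≤ ((n : ℝ) + m) ^ S.card := by
    have h2t : 0 < 2 / (t : ℝ) := by positivity
    have hb := one_add_mul_le_pow (a := 2 / (t : ℝ)) (by linarith) S.card
    have h1 : 3 ≤ 1 + (S.card : ℝ) * (2 / t) := by
      have : 2 ≤ (S.card : ℝ) * (2 / t) := by
        rw [← mul_div_assoc, le_div_iff₀ ht']; linarith
      linarith
    calc 3 * (n : ℝ) ^ S.card ≤ (1 + 2 / (t : ℝ)) ^ S.card * (n : ℝ) ^ S.card := by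
          gcongr; linarith
      _ = (n + 2 * n / t) ^ S.card := by rw [← mul_pow]; congr 1; ring
      _ ≤ _ := by gcongr
  have hpos : (0 : ℝ) < (n : ℝ) ^ S.card := by positivity
  have : (n : ℝ) ^ S.card * (3 * F) ≤ (n : ℝ) ^ S.card * N := by
    calc (n : ℝ) ^ S.card * (3 * F) = 3 * (n : ℝ) ^ S.card * F := by ring
      _ ≤ ((n : ℝ) + m) ^ S.card * F := by gcongr
      _ ≤ _ := h'
  exact le_of_mul_le_mul_left this hpos

/-- If each of `k` events fails for at most a third of the points of a finite space, then a
strict majority of them holds on at least a third of the space. -/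
theorem card_le_three_mul_card_majority {Ω : Type*} [Fintype Ω] {k : ℕ} (hk : 1 ≤ k)
    (P : Fin k → Ω → Prop)
    (hP : ∀ i, 3 * ((Finset.univ.filter fun ω => ¬ P i ω).card : ℝ) ≤ Fintype.card Ω) :
    (Fintype.card Ω : ℝ) ≤ 3 * ((Finset.univ.filter fun ω =>
      k < 2 * (Finset.univ.filter fun i => P i ω).card).card : ℝ) := by
  set G := Finset.univ.filter fun ω => k < 2 * (Finset.univ.filter fun i => P i ω).card
  have hkpos : (0 : ℝ) < k := by exact_mod_cast hk
  have hsum : ∑ ω, ((Finset.univ.filter fun i => P i ω).card : ℝ)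
      = ∑ i, ((Finset.univ.filter fun ω => P i ω).card : ℝ) := by
    simp only [Finset.card_filter, Nat.cast_sum]
    exact Finset.sum_comm
  have hlow : (k : ℝ) * (2 / 3 * Fintype.card Ω)
      ≤ ∑ i, ((Finset.univ.filter fun ω => P i ω).card : ℝ) := by
    calc (k : ℝ) * (2 / 3 * Fintype.card Ω) = ∑ _i : Fin k, (2 / 3 * (Fintype.card Ω : ℝ)) := by
          simp
      _ ≤ _ := Finset.sum_le_sum fun i _ => by
          have h1 := hP i
          have h2 : ((Finset.univ.filter fun ω => P i ω).card : ℝ)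
              + (Finset.univ.filter fun ω => ¬ P i ω).card = Fintype.card Ω := by
            exact_mod_cast Finset.card_filter_add_card_filter_not (s := Finset.univ) (P i)
          linarith
  have hup : ∑ ω, ((Finset.univ.filter fun i => P i ω).card : ℝ)
      ≤ ∑ ω, ((k : ℝ) / 2 + (k : ℝ) / 2 * if ω ∈ G then 1 else 0) := by
    refine Finset.sum_le_sum fun ω _ => ?_
    split_ifs with hω
    · have : (Finset.univ.filter fun i => P i ω).card ≤ k :=
        (Finset.card_le_univ _).trans (by simp)
      have : ((Finset.univ.filter fun i => P i ω).card : ℝ) ≤ k := by exact_mod_cast this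
      linarith
    · have : 2 * (Finset.univ.filter fun i => P i ω).card ≤ k := by
        simpa [G] using hω
      have : 2 * ((Finset.univ.filter fun i => P i ω).card : ℝ) ≤ k := by exact_mod_cast this
      linarith
  rw [Finset.sum_add_distrib, ← Finset.mul_sum] at hup
  simp only [Finset.sum_const, Finset.card_univ, nsmul_eq_mul, Finset.sum_ite_mem,
    Finset.univ_inter, mul_one] at hup
  have : (k : ℝ) * (Fintype.card Ω) ≤ k * (3 * G.card) := by linarith
  exact le_of_mul_le_mul_left this hkpos

/-- Number of functions avoiding a given set of values. -/
theorem card_filter_avoid {n r : ℕ} (T : Finset (Fin r)) :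
    (Finset.univ.filter fun C : Fin n → Fin r => ∀ i ∈ T, ∀ j, C j ≠ i).card
      = (r - T.card) ^ n := by
  have : (Finset.univ.filter fun C : Fin n → Fin r => ∀ i ∈ T, ∀ j, C j ≠ i)
      = Fintype.piFinset fun _ => Tᶜ := by
    ext C
    simp only [Finset.mem_filter, Finset.mem_univ, true_and, Fintype.mem_piFinset,
      Finset.mem_compl]
    exact ⟨fun h j hj => h _ hj j rfl, fun h i hi j hji => h j (hji ▸ hi)⟩
  rw [this, Fintype.card_piFinset_const, Finset.card_compl, Fintype.card_fin]

/-- The values missed by `C`. -/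
def unseen {n r : ℕ} (C : Fin n → Fin r) : Finset (Fin r) :=
  Finset.univ.filter fun i => ∀ j, C j ≠ i

theorem cands_nonempty {r d n : ℕ} (C : Fin n → Fin r) (h : d ≤ (unseen C).card) :
    (cands (d := d) C).Nonempty := by
  obtain ⟨T, hT, hc⟩ := Finset.exists_subset_card_eq h
  refine ⟨⟨T, hc⟩, ?_⟩
  simp only [cands, Finset.mem_filter, Finset.mem_univ, true_and]
  intro i hi
  simpa [unseen] using hT hi

theorem sum_card_unseen (n r : ℕ) :
    ∑ C : Fin n → Fin r, (unseen C).card = r * (r - 1) ^ n := by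
  simp only [unseen, Finset.card_filter]
  rw [Finset.sum_comm]
  simp only [← Finset.card_filter]
  have : ∀ i : Fin r, (Finset.univ.filter fun C : Fin n → Fin r => ∀ j, C j ≠ i).card
      = (r - 1) ^ n := fun i => by simpa using card_filter_avoid (n := n) {i}
  simp [this]

theorem sum_card_unseen_sq (n r : ℕ) :
    ∑ C : Fin n → Fin r, (unseen C).card ^ 2
      = r * (r - 1) ^ n + r * (r - 1) * (r - 2) ^ n := by
  have h1 : ∀ C : Fin n → Fin r, (unseen C).card ^ 2
      = ∑ i : Fin r, ∑ i' : Fin r, if ∀ x ∈ ({i, i'} : Finset (Fin r)), ∀ j, C j ≠ x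
        then 1 else 0 := by
    intro C
    rw [sq, unseen, Finset.card_filter, Finset.sum_mul_sum]
    refine Finset.sum_congr rfl fun i _ => Finset.sum_congr rfl fun i' _ => ?_
    simp only [Finset.mem_insert, Finset.mem_singleton, forall_eq_or_imp, forall_eq]
    split_ifs <;> simp_all
  simp only [h1]
  rw [Finset.sum_comm]
  have h2 : ∀ i : Fin r, (∑ C : Fin n → Fin r, ∑ i' : Fin r,
      if ∀ x ∈ ({i, i'} : Finset (Fin r)), ∀ j, C j ≠ x then 1 else 0)
      = (r - 1) ^ n + (r - 1) * (r - 2) ^ n := by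
    intro i
    rw [Finset.sum_comm]
    simp only [← Finset.card_filter, card_filter_avoid]
    rw [← Finset.add_sum_erase _ _ (Finset.mem_univ i)]
    congr 1
    · simp
    · rw [Finset.sum_congr rfl (g := fun _ => (r - 2) ^ n)]
      · simp
      · intro i' hi'
        rw [Finset.card_pair (Finset.ne_of_mem_erase hi').symm]
  rw [Finset.sum_congr rfl fun i _ => h2 i]
  simp
  ring

/-- Second moment bound: if on average at least `max (2d) 8` values are missed, then at least
half of all functions miss at least `d` values. -/
theorem half_le_card_unseen {n r d : ℕ} (hr : 2 ≤ r) (μ : ℝ)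
    (hμ : μ = r * ((r - 1) / r : ℝ) ^ n) (hd : 2 * (d : ℝ) ≤ μ) (h8 : 8 ≤ μ) :
    (r : ℝ) ^ n ≤ 2 * ((Finset.univ.filter fun C : Fin n → Fin r =>
      d ≤ (unseen C).card).card : ℝ) := by
  have hr0 : (0 : ℝ) < r := by positivity
  have hr2 : (2 : ℝ) ≤ r := by exact_mod_cast hr
  have hN : (0 : ℝ) < (r : ℝ) ^ n := by positivity
  have hA : ∑ C : Fin n → Fin r, ((unseen C).card : ℝ) = μ * r ^ n := by
    have := congrArg (Nat.cast (R := ℝ)) (sum_card_unseen n r)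
    push_cast [Nat.cast_sub (show 1 ≤ r by omega)] at this
    rw [this, hμ, div_pow]
    field_simp
  have hB : ∑ C : Fin n → Fin r, ((unseen C).card : ℝ) ^ 2 ≤ (μ + μ ^ 2) * r ^ n := by
    have := congrArg (Nat.cast (R := ℝ)) (sum_card_unseen_sq n r)
    push_cast [Nat.cast_sub (show 1 ≤ r by omega), Nat.cast_sub hr] at this
    rw [this, add_mul]
    have e1 : (r : ℝ) * (r - 1) ^ n = μ * r ^ n := by
      rw [hμ, div_pow]; field_simp
    have e2 : μ ^ 2 * r ^ n = r ^ 2 * ((r - 1) ^ 2 / r) ^ n := by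
      rw [hμ, div_pow, div_pow, ← pow_mul]; field_simp; ring
    rw [e1, e2]
    gcongr ?_ + ?_ * ?_ ^ n
    · nlinarith
    · linarith
    · rw [le_div_iff₀ hr0]; nlinarith
  have hV : ∑ C : Fin n → Fin r, (((unseen C).card : ℝ) - μ) ^ 2 ≤ μ * r ^ n := by
    have : ∑ C : Fin n → Fin r, (((unseen C).card : ℝ) - μ) ^ 2
        = ∑ C : Fin n → Fin r, ((unseen C).card : ℝ) ^ 2
          - 2 * μ * ∑ C : Fin n → Fin r, ((unseen C).card : ℝ) + r ^ n * μ ^ 2 := by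
      rw [Finset.mul_sum, ← Finset.sum_sub_distrib]
      have : (r : ℝ) ^ n * μ ^ 2 = ∑ _C : Fin n → Fin r, μ ^ 2 := by simp
      rw [this, ← Finset.sum_add_distrib]
      exact Finset.sum_congr rfl fun C _ => by ring
    rw [this, hA]
    linarith
  set bad := Finset.univ.filter fun C : Fin n → Fin r => ¬ d ≤ (unseen C).card with hbad
  set good := Finset.univ.filter fun C : Fin n → Fin r => d ≤ (unseen C).card
  have htot : (good.card : ℝ) + bad.card = (r : ℝ) ^ n := by
    have h : good.card + bad.card = (Finset.univ : Finset (Fin n → Fin r)).card :=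
      Finset.card_filter_add_card_filter_not (s := Finset.univ)
        (fun C : Fin n → Fin r => d ≤ (unseen C).card)
    rw [Finset.card_univ, Fintype.card_fun, Fintype.card_fin, Fintype.card_fin] at h
    exact_mod_cast h
  have hbadle : bad.card * (μ ^ 2 / 4) ≤ μ * r ^ n := by
    refine le_trans ?_ hV
    calc bad.card * (μ ^ 2 / 4) = ∑ _C ∈ bad, μ ^ 2 / 4 := by simp
      _ ≤ ∑ C ∈ bad, (((unseen C).card : ℝ) - μ) ^ 2 := by
          refine Finset.sum_le_sum fun C hC => ?_
          have h : (unseen C).card < d := by simpa [hbad] using hC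
          have h : ((unseen C).card : ℝ) < d := by exact_mod_cast h
          nlinarith
      _ ≤ _ := Finset.sum_le_sum_of_subset_of_nonneg (Finset.subset_univ _)
          fun _ _ _ => sq_nonneg _
  have : bad.card * (μ / 4) ≤ (r : ℝ) ^ n := by
    have : μ * (bad.card * (μ / 4)) ≤ μ * r ^ n := by linarith
    exact le_of_mul_le_mul_left this (by linarith)
  have : (bad.card : ℝ) * 2 ≤ (r : ℝ) ^ n := by
    refine le_trans ?_ this
    gcongr
    linarith
  linarith

/-- With `r = ⌈16n/log(n/d)⌉` values, the expected number of missed values is at least `8d`,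
while `r` is at most `32n/log(n/d)`. -/
theorem parameter_bounds {n d r : ℕ} (hd : 1 ≤ d) (hn : 16 * (d : ℝ) ≤ n)
    (hr : r = ⌈16 * (n : ℝ) / Real.log ((n : ℝ) / (d : ℝ))⌉₊) :
    2 ≤ r ∧ 8 * (d : ℝ) ≤ r * ((r - 1) / r : ℝ) ^ n ∧
      0 < Real.log ((n : ℝ) / d) ∧ (r : ℝ) * Real.log ((n : ℝ) / d) ≤ 32 * n := by
  have hd' : (1 : ℝ) ≤ d := by exact_mod_cast hd
  have hd0 : (0 : ℝ) < d := by linarith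
  have hn0 : (0 : ℝ) < n := by linarith
  set y : ℝ := (n : ℝ) / d with hy
  have hy16 : 16 ≤ y := by rw [hy, le_div_iff₀ hd0]; exact hn
  have hny : (n : ℝ) = d * y := by rw [hy]; field_simp
  set l := Real.log y with hl
  have hl0 : 0 < l := Real.log_pos (by linarith)
  have hly : l ≤ y - 1 := Real.log_le_sub_one_of_pos (by linarith)
  have hln : l ≤ n := by nlinarith
  have hexp : Real.exp l = y := Real.exp_log (by linarith)
  have hrl : 16 * (n : ℝ) / l ≤ r := by rw [hr]; exact Nat.le_ceil _
  have hrl' : 16 * (n : ℝ) ≤ r * l := by rwa [div_le_iff₀ hl0] at hrl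
  have hru : (r : ℝ) ≤ 16 * (n : ℝ) / l + 1 := by
    rw [hr]; exact (Nat.ceil_lt_add_one (by positivity)).le
  have h16 : 16 ≤ 16 * (n : ℝ) / l := by rw [le_div_iff₀ hl0]; linarith
  have hr16 : (16 : ℝ) ≤ r := h16.trans hrl
  have hr0 : (0 : ℝ) < r := by linarith
  refine ⟨by exact_mod_cast (by linarith : (2 : ℝ) ≤ r), ?_, hl0, ?_⟩
  · have hbase : Real.exp (-(2 / r)) ≤ ((r : ℝ) - 1) / r := by
      rw [Real.exp_neg, inv_le_iff_one_le_mul₀ (Real.exp_pos _)]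
      have h1 := Real.add_one_le_exp (2 / (r : ℝ))
      calc (1 : ℝ) ≤ (r - 1) / r * (2 / r + 1) := by
            rw [div_add_one hr0.ne', div_mul_div_comm, le_div_iff₀ (by positivity)]
            nlinarith
        _ ≤ _ := by
            gcongr
            exact div_nonneg (by linarith) hr0.le
    have hpow : Real.exp (-(l / 2)) ≤ (((r : ℝ) - 1) / r) ^ n := by
      calc Real.exp (-(l / 2)) ≤ Real.exp (n * (-(2 / r))) := by
            rw [Real.exp_le_exp, mul_neg, neg_le_neg_iff, ← mul_div_assoc, div_le_iff₀ hr0]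
            linarith
        _ = Real.exp (-(2 / r)) ^ n := Real.exp_nat_mul _ _
        _ ≤ _ := by gcongr
    have hhalf : l / 2 ≤ Real.exp (l / 2) := by linarith [Real.add_one_le_exp (l / 2)]
    calc 8 * (d : ℝ) = 16 * d / l * (l / 2) := by field_simp; norm_num
      _ ≤ 16 * d / l * Real.exp (l / 2) := by gcongr
      _ = 16 * d / l * (Real.exp l * Real.exp (-(l / 2))) := by
          rw [← Real.exp_add]; congr 2; ring
      _ = 16 * n / l * Real.exp (-(l / 2)) := by rw [hexp, hny]; ring
      _ ≤ _ := by gcongr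
  · calc (r : ℝ) * l ≤ (16 * (n : ℝ) / l + 1) * l := by gcongr
      _ = 16 * n + l := by field_simp
      _ ≤ _ := by linarith

/-- If the adversary has a candidate and a strict majority of the lists contain an inserted
point, then the vote errs on at least `d` of the points `x_i`. -/
theorem le_card_vote {r d n m k : ℕ} (hr : 0 < r) (L : Fin k → List (Fin (n + m)))
    (C : Fin n → Fin r) (hC : (cands (d := d) C).Nonempty) (π : Equiv.Perm (Fin (n + m)))
    (hπ : k < 2 * (Finset.univ.filter fun i : Fin k =>
      ¬ ∀ j ∈ (L i).toFinset, π j ∈ Finset.univ.map (Fin.castAddEmb (n := n) m)).card) :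
    d ≤ (Finset.univ.filter fun i : Fin r =>
      vote (d := d) k L hr C π (Sum.inl i) = true).card := by
  obtain ⟨T, hT, hadv⟩ := exists_advPoint_eq (d := d) hr C hC
  refine T.2.symm.le.trans (Finset.card_le_card fun x hx => ?_)
  simp only [Finset.mem_filter, Finset.mem_univ, true_and, vote, decide_eq_true_iff]
  refine hπ.trans_le (Nat.mul_le_mul_left 2 (Finset.card_le_card fun i hi => ?_))
  simp only [Finset.mem_filter, Finset.mem_univ, true_and] at hi ⊢
  push Not at hi
  obtain ⟨j, hj, hjA⟩ := hi
  have herm : ermE ((L i).map (sample (d := d) hr C π)) = hypT T := by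
    refine ermE_eq_hypT _ T ⟨_, List.mem_map_of_mem (List.mem_toFinset.1 hj), ?_⟩ ?_
    · simp only [sample]
      generalize π j = z at hjA
      induction z using Fin.addCases with
      | left a => exact absurd (Finset.mem_map_of_mem (Fin.castAddEmb m) (Finset.mem_univ a)) hjA
      | right a => rw [Fin.append_right, hadv]
    · intro q hq
      obtain ⟨j', -, rfl⟩ := List.mem_map.1 hq
      simp only [sample]
      generalize π j' = z
      induction z using Fin.addCases with
      | left a =>
        rw [Fin.append_left]
        exact Or.inr ⟨C a, fun h => hT _ h a rfl, rfl⟩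
      | right a => rw [Fin.append_right, hadv]; exact Or.inl rfl
  rw [herm]
  exact decide_eq_true hx

/-- majority-voting lower bound for the fixed adversarial ERM `E`. There
are constants `c, c' > 0` such that for all `d ≥ 1`, `n ≥ c·d`, `t ≥ 1`, `k ≥ 1`, with
`r = ⌈c·n/log(n/d)⌉` and `m = ⌈2n/t⌉`, for any fixed lists `L_1,…,L_k` of indices in
`{1,…,n+m}` each containing at least `t` distinct indices, the expected error (written
as a normalized sum over the clean sample `C ∼ D^n`, `D` uniform on `{x_1,…,x_r}`, and
over the uniformly random permutation `π`) of the majority vote is at least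
`d·log(n/d)/(c'·n)`. -/
theorem majority_vote_lower_bound_fixed_erm :
    ∃ c c' : ℝ, 0 < c ∧ 0 < c' ∧
      ∀ d n t k : ℕ, 1 ≤ d → c * (d : ℝ) ≤ (n : ℝ) → 1 ≤ t → 1 ≤ k →
      ∀ r m : ℕ, r = ⌈c * (n : ℝ) / Real.log ((n : ℝ) / (d : ℝ))⌉₊ →
        m = ⌈2 * (n : ℝ) / (t : ℝ)⌉₊ →
      ∀ hr : 0 < r,
      ∀ L : Fin k → List (Fin (n + m)), (∀ i, t ≤ (L i).toFinset.card) →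
      (d : ℝ) * Real.log ((n : ℝ) / (d : ℝ)) / (c' * (n : ℝ)) ≤
        (∑ C : Fin n → Fin r, ∑ π : Equiv.Perm (Fin (n + m)),
          ((Finset.univ.filter fun i : Fin r =>
              vote (d := d) k L hr C π (Sum.inl i) = true).card : ℝ) / (r : ℝ))
        / ((r : ℝ) ^ n * (Nat.factorial (n + m) : ℝ)) := by
  refine ⟨16, 192, by norm_num, by norm_num, ?_⟩
  intro d n t k hd hn ht hk r m hr_def hm_def hr L hL
  obtain ⟨hr2, hμ, hl0, hrl⟩ := parameter_bounds hd hn hr_def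
  have hd' : (1 : ℝ) ≤ d := by exact_mod_cast hd
  have hn0 : (0 : ℝ) < n := by linarith
  have hr0 : (0 : ℝ) < r := by exact_mod_cast hr
  have hgood := half_le_card_unseen (n := n) (d := d) hr2 _ rfl (by linarith) (by linarith)
  set good := Finset.univ.filter fun C : Fin n → Fin r => d ≤ (unseen C).card with hgood_def
  have hmiss : 2 * (n : ℝ) / (t : ℝ) ≤ m := by rw [hm_def]; exact Nat.le_ceil _
  have hmaj := card_le_three_mul_card_majority (Ω := Equiv.Perm (Fin (n + m))) hk
    (fun i π => ¬ ∀ j ∈ (L i).toFinset, π j ∈ Finset.univ.map (Fin.castAddEmb (n := n) m))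
    (fun i => by
      simp only [not_not]
      rw [Fintype.card_perm, Fintype.card_fin]
      exact three_mul_card_miss_le (by exact_mod_cast hn0) ht hmiss _ (hL i))
  rw [Fintype.card_perm, Fintype.card_fin] at hmaj
  set maj := Finset.univ.filter fun π : Equiv.Perm (Fin (n + m)) =>
    k < 2 * (Finset.univ.filter fun i : Fin k => ¬ ∀ j ∈ (L i).toFinset,
      π j ∈ Finset.univ.map (Fin.castAddEmb (n := n) m)).card with hmaj_def
  have hmaj' : ((n + m).factorial : ℝ) ≤ 3 * maj.card := by convert hmaj
  have hsum : (good.card : ℝ) * (maj.card * (d / r)) ≤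
      ∑ C : Fin n → Fin r, ∑ π : Equiv.Perm (Fin (n + m)),
          ((Finset.univ.filter fun i : Fin r =>
              vote (d := d) k L hr C π (Sum.inl i) = true).card : ℝ) / (r : ℝ) := by
    calc (good.card : ℝ) * (maj.card * (d / r)) = ∑ _C ∈ good, ∑ _π ∈ maj, (d / r : ℝ) := by
          simp
      _ ≤ ∑ C ∈ good, ∑ π ∈ maj, ((Finset.univ.filter fun i : Fin r =>
              vote (d := d) k L hr C π (Sum.inl i) = true).card : ℝ) / (r : ℝ) := by
          refine Finset.sum_le_sum fun C hC => Finset.sum_le_sum fun π hπ => ?_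
          gcongr
          exact le_card_vote hr L C (cands_nonempty C (Finset.mem_filter.1 hC).2) π
            (Finset.mem_filter.1 hπ).2
      _ ≤ ∑ C ∈ good, ∑ π : Equiv.Perm (Fin (n + m)), ((Finset.univ.filter fun i : Fin r =>
              vote (d := d) k L hr C π (Sum.inl i) = true).card : ℝ) / (r : ℝ) :=
          Finset.sum_le_sum fun C _ => Finset.sum_le_sum_of_subset_of_nonneg
            (Finset.subset_univ _) fun _ _ _ => by positivity
      _ ≤ _ := Finset.sum_le_sum_of_subset_of_nonneg (Finset.subset_univ _)
            fun _ _ _ => Finset.sum_nonneg fun _ _ => by positivity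
  have hfac : (0 : ℝ) < (n + m).factorial := by exact_mod_cast Nat.factorial_pos _
  rw [le_div_iff₀ (by positivity)]
  refine le_trans ?_ hsum
  have hdr : (d : ℝ) * Real.log ((n : ℝ) / d) / (192 * n) ≤ 1 / 6 * (d / r) := by
    rw [← mul_div_assoc, div_le_div_iff₀ (by positivity) hr0]
    nlinarith
  calc (d : ℝ) * Real.log ((n : ℝ) / d) / (192 * n) * ((r : ℝ) ^ n * (n + m).factorial)
      ≤ 1 / 6 * (d / r) * ((2 * good.card) * (3 * maj.card)) := by gcongr
    _ = _ := by ring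

end
end

section
/- There exists a constant c > 0 such that for every integer n ≥ c the following holds. Let X = {x_1,…,x_{2n}} ∪ {y_1,…,y_{2n}}, let H consist of the all-zero function h⋆ together with, for each i ∈ {1,…,2n}, the function h_i that is 1 exactly on {x_i, y_i}, and let D be uniform on {x_1,…,x_{2n}}. Draw a clean sample C = (c_1,…,c_n) ∼ D^n and let the adversary output (ỹ_1,…,ỹ_n) where ỹ_j = y_i whenever c_j = x_i. Let h_S be the (randomized) output of the OIG predictor for H with orientation rule O*_rand, trained on the 2n examples consisting of the points of C and the adversarial points, all labeled 0 by h⋆. Then E[ err_{D,h⋆}(h_S) ] ≥ 1/4, where the expectation is over C, the random orientation, and the test point. -/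
open Classical

noncomputable section

/-- `v ∈ {0,1}^M` is a vertex of the one-inclusion graph of `H` on `z_1, …, z_M`. -/
def IsOIGVertex {X : Type*} (H : Set (X → Bool)) {M : ℕ} (z : Fin M → X)
    (v : Fin M → Bool) : Prop :=
  ∃ h ∈ H, ∀ i, h (z i) = v i

/-- `u, v` is an edge of the one-inclusion graph: both are vertices and they differ
in exactly one coordinate. -/
def IsOIGEdge {X : Type*} (H : Set (X → Bool)) {M : ℕ} (z : Fin M → X)
    (u v : Fin M → Bool) : Prop :=
  IsOIGVertex H z u ∧ IsOIGVertex H z v ∧ (∃! i, u i ≠ v i)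

/-- An orientation of the one-inclusion graph, encoded as a finite set `σ` of ordered
pairs: `(u, v) ∈ σ` means the edge `{u, v}` is assigned to the endpoint `v` (so it
counts towards the out-degree of `u`). -/
def IsOrientation {X : Type*} (H : Set (X → Bool)) {M : ℕ} (z : Fin M → X)
    (σ : Finset ((Fin M → Bool) × (Fin M → Bool))) : Prop :=
  (∀ p ∈ σ, IsOIGEdge H z p.1 p.2) ∧
  ∀ u v : Fin M → Bool, IsOIGEdge H z u v → ((u, v) ∈ σ ↔ (v, u) ∉ σ)

/-- The maximum out-degree of an orientation. -/
def maxOutDeg {M : ℕ} (σ : Finset ((Fin M → Bool) × (Fin M → Bool))) : ℕ :=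
  Finset.univ.sup fun u : Fin M → Bool => (σ.filter fun p => p.1 = u).card

/-- `σ` is an orientation minimizing the maximum out-degree. -/
def MinimizesMaxOutDeg {X : Type*} (H : Set (X → Bool)) {M : ℕ} (z : Fin M → X)
    (σ : Finset ((Fin M → Bool) × (Fin M → Bool))) : Prop :=
  IsOrientation H z σ ∧
  ∀ σ', IsOrientation H z σ' → maxOutDeg σ ≤ maxOutDeg σ'

/-- The one-inclusion graph predictor (training points followed by the test point). -/
def oigPredict {X : Type*} (H : Set (X → Bool)) {N : ℕ} (z : Fin (N + 1) → X)
    (σ : Finset ((Fin (N + 1) → Bool) × (Fin (N + 1) → Bool))) (b : Fin N → Bool) :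
    Bool :=
  if IsOIGVertex H z (Fin.snoc b false) ∧ IsOIGVertex H z (Fin.snoc b true) then
    decide ((Fin.snoc b false, Fin.snoc b true) ∈ σ)
  else if IsOIGVertex H z (Fin.snoc b true) then true
  else false

/-- The class on `X = {1,…,2n} × {0,1}` (where `x_i = (i, false)`, `y_i = (i, true)`)
consisting of the all-zero target `h⋆` and, for each `i`, the hypothesis `h_i` that is
`1` exactly on `{x_i, y_i}`. -/
def Hcl (n : ℕ) : Set (Fin (2 * n) × Bool → Bool) :=
  {f | f = (fun _ => false) ∨ ∃ i : Fin (2 * n), f = fun p => decide (p.1 = i)}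

/-- The training points: the clean sample `x_{C 1}, …, x_{C n}` followed by the
adversarial points `y_{C 1}, …, y_{C n}`. -/
def train (n : ℕ) (C : Fin n → Fin (2 * n)) : Fin (n + n) → Fin (2 * n) × Bool :=
  Fin.append (fun j => (C j, false)) (fun j => (C j, true))

theorem isOrientation_singleton {X : Type*} {H : Set (X → Bool)} {M : ℕ} {z : Fin M → X}
    {p q : Fin M → Bool} (hpq : p ≠ q)
    (hE : ∀ u v, IsOIGEdge H z u v ↔ (u = p ∧ v = q) ∨ (u = q ∧ v = p)) :
    IsOrientation H z {(p, q)} := by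
  refine ⟨fun a ha => ?_, fun u v huv => ?_⟩
  · rw [Finset.mem_singleton] at ha
    subst ha
    exact (hE _ _).2 (Or.inl ⟨rfl, rfl⟩)
  · rcases (hE _ _).1 huv with ⟨rfl, rfl⟩ | ⟨rfl, rfl⟩
    · simp [hpq, hpq.symm]
    · simp [hpq, hpq.symm]

theorem eq_singleton_of_isOrientation {X : Type*} {H : Set (X → Bool)} {M : ℕ} {z : Fin M → X}
    {p q : Fin M → Bool}
    (hE : ∀ u v, IsOIGEdge H z u v ↔ (u = p ∧ v = q) ∨ (u = q ∧ v = p))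
    {σ : Finset ((Fin M → Bool) × (Fin M → Bool))} (hσ : IsOrientation H z σ) :
    σ = {(p, q)} ∨ σ = {(q, p)} := by
  obtain ⟨hsub, hor⟩ := hσ
  have key := hor p q ((hE _ _).2 (Or.inl ⟨rfl, rfl⟩))
  have hs : ∀ a ∈ σ, a = (p, q) ∨ a = (q, p) := by
    rintro ⟨u, v⟩ ha
    rcases (hE _ _).1 (hsub _ ha) with ⟨h1, h2⟩ | ⟨h1, h2⟩
    · exact Or.inl (Prod.ext h1 h2)
    · exact Or.inr (Prod.ext h1 h2)
  by_cases h : (p, q) ∈ σ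
  · refine Or.inl (Finset.eq_singleton_iff_unique_mem.2 ⟨h, fun a ha => ?_⟩)
    rcases hs a ha with rfl | rfl
    · rfl
    · exact absurd ha (key.1 h)
  · have h' : (q, p) ∈ σ := by
      by_contra h'
      exact h (key.2 h')
    refine Or.inr (Finset.eq_singleton_iff_unique_mem.2 ⟨h', fun a ha => ?_⟩)
    rcases hs a ha with rfl | rfl
    · exact absurd ha h
    · rfl

theorem maxOutDeg_singleton {M : ℕ} (p q : Fin M → Bool) : maxOutDeg {(p, q)} = 1 := by
  refine le_antisymm (Finset.sup_le fun u _ => ?_) ?_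
  · exact (Finset.card_filter_le _ _).trans (by simp)
  · refine le_trans ?_ (Finset.le_sup (Finset.mem_univ p))
    simp [Finset.filter_singleton]

/-- If the one-inclusion graph has a single edge, both of its orientations are optimal. -/
theorem filter_minimizesMaxOutDeg {X : Type*} {H : Set (X → Bool)} {M : ℕ} {z : Fin M → X}
    {p q : Fin M → Bool} (hpq : p ≠ q)
    (hE : ∀ u v, IsOIGEdge H z u v ↔ (u = p ∧ v = q) ∨ (u = q ∧ v = p)) :
    (Finset.univ.filter fun σ => MinimizesMaxOutDeg H z σ) = {{(p, q)}, {(q, p)}} := by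
  have hE' : ∀ u v, IsOIGEdge H z u v ↔ (u = q ∧ v = p) ∨ (u = p ∧ v = q) :=
    fun u v => (hE u v).trans or_comm
  have hdeg : ∀ σ, IsOrientation H z σ → maxOutDeg σ = 1 := by
    intro σ hσ
    rcases eq_singleton_of_isOrientation hE hσ with rfl | rfl <;> exact maxOutDeg_singleton _ _
  ext σ
  simp only [Finset.mem_filter, Finset.mem_univ, true_and, Finset.mem_insert,
    Finset.mem_singleton]
  constructor
  · exact fun h => eq_singleton_of_isOrientation hE h.1
  · intro h
    have hσ : IsOrientation H z σ := by
      rcases h with rfl | rfl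
      · exact isOrientation_singleton hpq hE
      · exact isOrientation_singleton hpq.symm hE'
    exact ⟨hσ, fun σ' hσ' => by rw [hdeg σ hσ, hdeg σ' hσ']⟩

theorem snoc_false_ne_snoc_true {N : ℕ} (b : Fin N → Bool) :
    (Fin.snoc b false : Fin (N + 1) → Bool) ≠ Fin.snoc b true := by
  intro h
  simpa using congrFun h (Fin.last N)

theorem isOIGVertex_snoc_false (n : ℕ) (C : Fin n → Fin (2 * n)) (i : Fin (2 * n)) :
    IsOIGVertex (Hcl n) (Fin.snoc (train n C) (i, false) : Fin (n + n + 1) → _)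
      (Fin.snoc (fun _ => false) false) := by
  refine ⟨fun _ => false, Or.inl rfl, fun t => ?_⟩
  induction t using Fin.lastCases <;> simp

theorem train_fst_ne {n : ℕ} {C : Fin n → Fin (2 * n)} {i : Fin (2 * n)} (hi : ∀ j, C j ≠ i)
    (t : Fin (n + n)) : (train n C t).1 ≠ i := by
  induction t using Fin.addCases <;>
    simp only [train, Fin.append_left, Fin.append_right, ne_eq, hi, not_false_eq_true]

theorem isOIGVertex_snoc_true {n : ℕ} {C : Fin n → Fin (2 * n)} {i : Fin (2 * n)}
    (hi : ∀ j, C j ≠ i) :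
    IsOIGVertex (Hcl n) (Fin.snoc (train n C) (i, false) : Fin (n + n + 1) → _)
      (Fin.snoc (fun _ => false) true) := by
  refine ⟨fun p => decide (p.1 = i), Or.inr ⟨i, rfl⟩, fun t => ?_⟩
  induction t using Fin.lastCases <;> simp [train_fst_ne hi]

theorem exists_ne_train_fst_eq {n : ℕ} (C : Fin n → Fin (2 * n)) (t : Fin (n + n)) :
    ∃ s, s ≠ t ∧ (train n C s).1 = (train n C t).1 := by
  induction t using Fin.addCases with
  | left j =>
    refine ⟨Fin.natAdd n j, fun h => ?_, by
      simp only [train, Fin.append_left, Fin.append_right]⟩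
    have := congrArg Fin.val h
    simp at this
    omega
  | right j =>
    refine ⟨Fin.castAdd n j, fun h => ?_, by
      simp only [train, Fin.append_left, Fin.append_right]⟩
    have := congrArg Fin.val h
    simp at this
    omega

theorem apply_eq_of_mem_Hcl {n : ℕ} {f : Fin (2 * n) × Bool → Bool} (hf : f ∈ Hcl n)
    {a b : Fin (2 * n) × Bool} (hab : a.1 = b.1) : f a = f b := by
  rcases hf with rfl | ⟨k, rfl⟩ <;> simp [hab]

theorem eq_of_mem_Hcl_of_apply {n : ℕ} {f g : Fin (2 * n) × Bool → Bool} (hf : f ∈ Hcl n)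
    (hg : g ∈ Hcl n) {a : Fin (2 * n) × Bool} (hfa : f a = true) (hga : g a = true) : f = g := by
  rcases hf with rfl | ⟨k, rfl⟩
  · simp at hfa
  rcases hg with rfl | ⟨l, rfl⟩
  · simp at hga
  simp only [decide_eq_true_eq] at hfa hga
  rw [← hfa, ← hga]

/-- When the test index is unseen, the one-inclusion graph has exactly one edge: the one in the
direction of the test point at the all-zero vertex. -/
theorem isOIGEdge_Hcl_iff {n : ℕ} {C : Fin n → Fin (2 * n)} {i : Fin (2 * n)}
    (hi : ∀ j, C j ≠ i) (u v : Fin (n + n + 1) → Bool) :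
    IsOIGEdge (Hcl n) (Fin.snoc (train n C) (i, false) : Fin (n + n + 1) → _) u v ↔
      (u = Fin.snoc (fun _ => false) false ∧ v = Fin.snoc (fun _ => false) true) ∨
      (u = Fin.snoc (fun _ => false) true ∧ v = Fin.snoc (fun _ => false) false) := by
  have huniq : ∃! t, (Fin.snoc (fun _ => false) false : Fin (n + n + 1) → Bool) t ≠
      (Fin.snoc (fun _ => false) true : Fin (n + n + 1) → Bool) t := by
    refine ⟨Fin.last _, by simp, fun t => ?_⟩
    induction t using Fin.lastCases <;> simp
  constructor
  · rintro ⟨⟨f, hf, hfu⟩, ⟨g, hg, hgv⟩, t, ht, hun⟩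
    have hlast : t = Fin.last (n + n) := by
      induction t using Fin.lastCases with
      | last => rfl
      | cast t =>
        exfalso
        obtain ⟨s, hst, hs⟩ := exists_ne_train_fst_eq C t
        refine hst (Fin.castSucc_injective _ (hun _ ?_))
        rw [← hfu, ← hgv] at ht ⊢
        simp only [Fin.snoc_castSucc] at ht ⊢
        rwa [apply_eq_of_mem_Hcl hf hs, apply_eq_of_mem_Hcl hg hs]
    subst hlast
    have heq : ∀ s : Fin (n + n), u s.castSucc = v s.castSucc := by
      intro s
      by_contra h
      exact (Fin.castSucc_lt_last s).ne (hun _ h)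
    have hfg : f ≠ g := by
      rintro rfl
      exact ht ((hfu _).symm.trans (hgv _))
    have hu : ∀ s : Fin (n + n), u s.castSucc = false := by
      intro s
      by_contra h
      rw [Bool.not_eq_false] at h
      exact hfg (eq_of_mem_Hcl_of_apply hf hg ((hfu _).trans h)
        ((hgv _).trans ((heq s).symm.trans h)))
    have hw : ∀ (w : Fin (n + n + 1) → Bool) (b : Bool), (∀ s : Fin (n + n), w s.castSucc = false) →
        w (Fin.last _) = b → w = Fin.snoc (fun _ => false) b := by
      intro w b h1 h2
      funext s
      induction s using Fin.lastCases <;> simp [h1, h2]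
    have hv : ∀ s : Fin (n + n), v s.castSucc = false := fun s => (heq s).symm.trans (hu s)
    cases hul : u (Fin.last _) with
    | false =>
      have hvl : v (Fin.last _) = true := by simpa [hul] using ht.symm
      exact Or.inl ⟨hw u _ hu hul, hw v _ hv hvl⟩
    | true =>
      have hvl : v (Fin.last _) = false := by simpa [hul] using ht.symm
      exact Or.inr ⟨hw u _ hu hul, hw v _ hv hvl⟩
  · rintro (⟨rfl, rfl⟩ | ⟨rfl, rfl⟩)
    · exact ⟨isOIGVertex_snoc_false n C i, isOIGVertex_snoc_true hi, huniq⟩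
    · exact ⟨isOIGVertex_snoc_true hi, isOIGVertex_snoc_false n C i,
        by simpa only [ne_comm] using huniq⟩

/-- The probability that the predictor errs on an unseen test index is one half. -/
theorem error_eq_half_of_unseen {n : ℕ} {C : Fin n → Fin (2 * n)} {i : Fin (2 * n)}
    (hi : ∀ j, C j ≠ i) :
    (∑ σ ∈ Finset.univ.filter (fun σ =>
        MinimizesMaxOutDeg (Hcl n) (Fin.snoc (train n C) (i, false)) σ),
      (if oigPredict (Hcl n) (Fin.snoc (train n C) (i, false)) σ
          (fun _ => false) = true then (1 : ℝ) else 0))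
    / ((Finset.univ.filter (fun σ =>
        MinimizesMaxOutDeg (Hcl n) (Fin.snoc (train n C) (i, false)) σ)).card : ℝ) = 1 / 2 := by
  have hne := snoc_false_ne_snoc_true (fun _ : Fin (n + n) => false)
  have hne' : ({((Fin.snoc (fun _ => false) false : Fin (n + n + 1) → Bool),
      (Fin.snoc (fun _ => false) true : Fin (n + n + 1) → Bool))} : Finset _) ≠
      {((Fin.snoc (fun _ => false) true : Fin (n + n + 1) → Bool),
      (Fin.snoc (fun _ => false) false : Fin (n + n + 1) → Bool))} := by
    simp [hne]
  rw [filter_minimizesMaxOutDeg hne (isOIGEdge_Hcl_iff hi), Finset.sum_pair hne',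
    Finset.card_pair hne']
  simp [oigPredict, isOIGVertex_snoc_false n C i, isOIGVertex_snoc_true hi, hne]

theorem card_filter_forall_ne (n m : ℕ) (i : Fin m) :
    (Finset.univ.filter fun C : Fin n → Fin m => ∀ j, C j ≠ i).card = (m - 1) ^ n := by
  have h : (Finset.univ.filter fun C : Fin n → Fin m => ∀ j, C j ≠ i) =
      Fintype.piFinset fun _ => Finset.univ.erase i := by
    ext C
    simp [Fintype.mem_piFinset]
  rw [h, Fintype.card_piFinset]
  simp

theorem half_mul_pow_le (n : ℕ) (hn : 1 ≤ n) :
    (1 / 2 : ℝ) * (2 * (n : ℝ)) ^ n ≤ (2 * (n : ℝ) - 1) ^ n := by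
  have hn' : (1 : ℝ) ≤ n := by exact_mod_cast hn
  have hb := one_add_mul_le_pow (a := -(1 / (2 * (n : ℝ)))) (by
    have : 1 / (2 * (n : ℝ)) ≤ 1 := by
      rw [div_le_one (by positivity)]
      linarith
    linarith) n
  have h1 : 1 + (n : ℝ) * -(1 / (2 * (n : ℝ))) = 1 / 2 := by
    field_simp
    norm_num
  have h2 : 2 * (n : ℝ) - 1 = (1 + -(1 / (2 * (n : ℝ)))) * (2 * (n : ℝ)) := by
    field_simp
    ring
  rw [h1] at hb
  rw [h2, mul_pow _ (2 * (n : ℝ))]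
  exact mul_le_mul_of_nonneg_right hb (by positivity)

/-- there is a constant `c > 0` such that for every `n ≥ c`, in the above
setting, the OIG predictor with a uniformly random maximum-out-degree-minimizing
orientation `O*_rand` (drawn for each constructed graph), trained on the `2n` points of
the clean sample `C ∼ D^n` (with `D` uniform on `{x_1,…,x_{2n}}`, formalized as uniform
over tuples `C : Fin n → Fin 2n`) and the adversarial points, all labeled `0`, has
expected error at least `1/4`; the expectation (written as a normalized sum) is over
`C`, the uniformly random test point, and the uniformly random minimizing
orientation. -/
theorem oig_lower_bound_constant :
    ∃ c : ℝ, 0 < c ∧ ∀ n : ℕ, c ≤ (n : ℝ) →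
      (1 : ℝ) / 4 ≤
        (∑ C : Fin n → Fin (2 * n), ∑ i : Fin (2 * n),
          (∑ σ ∈ Finset.univ.filter (fun σ =>
              MinimizesMaxOutDeg (Hcl n) (Fin.snoc (train n C) (i, false)) σ),
            (if oigPredict (Hcl n) (Fin.snoc (train n C) (i, false)) σ
                (fun _ => false) = true then (1 : ℝ) else 0))
          / ((Finset.univ.filter (fun σ =>
              MinimizesMaxOutDeg (Hcl n) (Fin.snoc (train n C) (i, false)) σ)).card : ℝ))
        / ((2 * (n : ℝ)) ^ n * (2 * (n : ℝ))) := by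
  refine ⟨1, one_pos, fun n hn => ?_⟩
  have hn1 : 1 ≤ n := by exact_mod_cast hn
  rw [le_div_iff₀ (by positivity), Finset.sum_comm]
  have hi : ∀ i : Fin (2 * n), (1 / 4 : ℝ) * (2 * (n : ℝ)) ^ n ≤
      ∑ C : Fin n → Fin (2 * n), if ∀ j, C j ≠ i then (1 / 2 : ℝ) else 0 := by
    intro i
    rw [← Finset.sum_filter, Finset.sum_const, card_filter_forall_ne, nsmul_eq_mul,
      Nat.cast_pow, Nat.cast_sub (by omega)]
    push_cast
    linarith [half_mul_pow_le n hn1]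
  calc (1 / 4 : ℝ) * ((2 * (n : ℝ)) ^ n * (2 * (n : ℝ)))
      = ∑ _i : Fin (2 * n), (1 / 4 : ℝ) * (2 * (n : ℝ)) ^ n := by
        rw [Finset.sum_const, Finset.card_univ, Fintype.card_fin, nsmul_eq_mul]
        push_cast
        ring
    _ ≤ _ := Finset.sum_le_sum fun i _ => (hi i).trans (Finset.sum_le_sum fun C _ => ?_)
  split_ifs with h
  · exact (error_eq_half_of_unseen h).ge
  · exact div_nonneg (Finset.sum_nonneg fun σ _ => by split_ifs <;> norm_num) (Nat.cast_nonneg _)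

end
end

section
/- Let N ≥ 1 be an integer, X = {1,…,N} × {0,1}, and write x_i = (i,0), y_i = (i,1). Let H consist of the all-zero function h⋆ together with, for each i ∈ {1,…,N}, the function h_i that is 1 exactly on {x_i, y_i}. Let F ⊆ X be a finite set such that for every i, x_i ∈ F if and only if y_i ∈ F, let j ∈ {1,…,N} with x_j ∉ F, and set G = F ∪ {x_j}. Then: (i) the restrictions of h⋆ and h_j to G differ at exactly one point of G, namely x_j; and (ii) for any h, h' ∈ H whose restrictions to G differ at exactly one point of G, these two restrictions are (in some order) equal to the restrictions of h⋆ and h_j to G. In other words, the one-inclusion graph of H on any enumeration of G has exactly one edge, joining the all-zero vertex to the vertex of h_j. -/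
open Classical

/-- The hypothesis `h_i` on `X = {1,…,N} × {0,1}` that is `1` exactly on
`{x_i, y_i} = {(i,0),(i,1)}`. -/
def hyp (N : ℕ) (i : Fin N) : Fin N × Bool → Bool := fun p => decide (p.1 = i)

/-- The class consisting of the all-zero function `h⋆` together with the `h_i`. -/
def Hpairs (N : ℕ) : Set (Fin N × Bool → Bool) :=
  {f | f = (fun _ => false) ∨ ∃ i : Fin N, f = hyp N i}

theorem Hpairs.apply_eq_of_fst_eq {N : ℕ} {h : Fin N × Bool → Bool} (hh : h ∈ Hpairs N)
    {p q : Fin N × Bool} (hpq : p.1 = q.1) : h p = h q := by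
  rcases hh with rfl | ⟨i, rfl⟩
  · rfl
  · simp [hyp, hpq]

theorem Hpairs.eq_hyp_of_apply_eq_true {N : ℕ} {h : Fin N × Bool → Bool} (hh : h ∈ Hpairs N)
    {p : Fin N × Bool} (hp : h p = true) : h = hyp N p.1 := by
  rcases hh with rfl | ⟨i, rfl⟩
  · simp at hp
  · simp only [hyp, decide_eq_true_eq] at hp
    rw [hp]

/-- Two members of `Hpairs N` differing at only one point of `insert x F`, where `F` is a union of
pairs, agree on `F`. -/
theorem Hpairs.eqOn_of_card_filter_ne_eq_one {N : ℕ} {F : Finset (Fin N × Bool)}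
    (hF : ∀ i : Fin N, (i, false) ∈ F ↔ (i, true) ∈ F) {x : Fin N × Bool}
    {h h' : Fin N × Bool → Bool} (hh : h ∈ Hpairs N) (hh' : h' ∈ Hpairs N)
    (hcard : ((insert x F).filter (fun p => h p ≠ h' p)).card = 1)
    {p : Fin N × Bool} (hp : p ∈ F) : h p = h' p := by
  by_contra hne
  have hq : (p.1, !p.2) ∈ F := by
    obtain ⟨i, b⟩ := p
    cases b
    · exact (hF i).1 hp
    · exact (hF i).2 hp
  have hne' : h (p.1, !p.2) ≠ h' (p.1, !p.2) := by
    rwa [apply_eq_of_fst_eq hh (p := (p.1, !p.2)) (q := p) rfl,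
      apply_eq_of_fst_eq hh' (p := (p.1, !p.2)) (q := p) rfl]
  have heq := Finset.card_le_one.1 hcard.le p
    (Finset.mem_filter.2 ⟨Finset.mem_insert_of_mem hp, hne⟩) (p.1, !p.2)
    (Finset.mem_filter.2 ⟨Finset.mem_insert_of_mem hq, hne'⟩)
  simpa using congrArg Prod.snd heq

/-- Let `F ⊆ {1,…,N} × {0,1}` be closed under `(i,0) ↔ (i,1)`, let
`x_j = (j, false) ∉ F`, and `G = F ∪ {x_j}`. Then (i) the restrictions of the all-zero
function `h⋆` and of `h_j` to `G` differ exactly at `x_j`; and (ii) any two members of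
`H` whose restrictions to `G` differ at exactly one point of `G` restrict on `G`, in
some order, to the restrictions of `h⋆` and `h_j`.  (So the one-inclusion graph of `H`
on `G` has exactly one edge, joining the all-zero vertex to the vertex of `h_j`.) -/
theorem one_inclusion_single_edge (N : ℕ) (hN : 1 ≤ N) (F : Finset (Fin N × Bool))
    (hF : ∀ i : Fin N, (i, false) ∈ F ↔ (i, true) ∈ F)
    (j : Fin N) (hjF : (j, false) ∉ F) :
    ((insert (j, false) F).filter
        (fun p => (fun _ => false : Fin N × Bool → Bool) p ≠ hyp N j p) = {(j, false)}) ∧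
    (∀ h ∈ Hpairs N, ∀ h' ∈ Hpairs N,
      ((insert (j, false) F).filter (fun p => h p ≠ h' p)).card = 1 →
      ((∀ p ∈ insert (j, false) F, h p = false ∧ h' p = hyp N j p) ∨
       (∀ p ∈ insert (j, false) F, h p = hyp N j p ∧ h' p = false))) := by
  have hypF : ∀ p ∈ F, hyp N j p = false := by
    rintro ⟨i, b⟩ hp
    simp only [hyp, decide_eq_false_iff_not]
    rintro rfl
    cases b
    · exact hjF hp
    · exact hjF ((hF i).2 hp)
  refine ⟨?_, fun h hh h' hh' hcard => ?_⟩
  · ext p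
    simp only [Finset.mem_filter, Finset.mem_insert, Finset.mem_singleton]
    constructor
    · rintro ⟨rfl | hp, hne⟩
      · rfl
      · exact absurd (hypF p hp).symm hne
    · rintro rfl
      simp [hyp]
  · have hagree : ∀ p ∈ F, h p = h' p := fun p hp =>
      Hpairs.eqOn_of_card_filter_ne_eq_one hF hh hh' hcard hp
    have hne : h (j, false) ≠ h' (j, false) := by
      obtain ⟨q, hq⟩ := Finset.card_pos.1 (hcard ▸ Nat.one_pos)
      obtain ⟨hqG, hq⟩ := Finset.mem_filter.1 hq
      rcases Finset.mem_insert.1 hqG with rfl | hqF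
      · exact hq
      · exact absurd (hagree q hqF) hq
    cases hj : h (j, false)
    · left
      have hj' : h' (j, false) = true := by simpa [hj] using hne.symm
      obtain rfl : h' = hyp N j := Hpairs.eq_hyp_of_apply_eq_true hh' hj'
      refine fun p hp => ⟨?_, rfl⟩
      rcases Finset.mem_insert.1 hp with rfl | hp
      · exact hj
      · rw [hagree p hp, hypF p hp]
    · right
      have hj' : h' (j, false) = false := by simpa [hj] using hne.symm
      obtain rfl : h = hyp N j := Hpairs.eq_hyp_of_apply_eq_true hh hj
      refine fun p hp => ⟨rfl, ?_⟩
      rcases Finset.mem_insert.1 hp with rfl | hp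
      · exact hj'
      · rw [← hagree p hp, hypF p hp]
end

section
/- Let r ≥ 3 and n ≥ 1 be integers with n ≤ (r² − 2r)/32. Let s_1,…,s_n be i.i.d. uniform samples from {1,…,r} and let U = |{i ∈ {1,…,r} : i ∉ {s_1,…,s_n}}| be the number of unsampled elements. Then Pr[ U ≤ (1/2)·r·(1 − 1/r)^n ] ≤ 4/(r·(1 − 1/r)^n) + 1/4. -/
open Classical

open Finset in
theorem sum_avoiding_indicator {α : Type*} [Fintype α] [DecidableEq α] (n : ℕ) (T : Finset α) :
    ∑ s : Fin n → α, (if ∀ j, s j ∉ T then (1 : ℝ) else 0)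
      = ((Fintype.card α : ℝ) - #T) ^ n := by
  have h : (univ.filter fun s : Fin n → α => ∀ j, s j ∉ T)
      = Fintype.piFinset fun _ : Fin n => Tᶜ := by
    ext s; simp [Fintype.mem_piFinset]
  rw [sum_boole, h, Fintype.card_piFinset_const, card_compl, Nat.cast_pow,
    Nat.cast_sub (card_le_univ T)]

open Finset in
theorem sum_card_missed {α : Type*} [Fintype α] [DecidableEq α] (n : ℕ) :
    ∑ s : Fin n → α, (#{i | ∀ j, s j ≠ i} : ℝ)
      = (Fintype.card α : ℝ) * ((Fintype.card α : ℝ) - 1) ^ n := by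
  simp_rw [← sum_boole]
  rw [sum_comm]
  have h (i : α) : ∑ s : Fin n → α, (if ∀ j, s j ≠ i then (1 : ℝ) else 0)
      = ((Fintype.card α : ℝ) - 1) ^ n := by
    simpa using sum_avoiding_indicator n {i}
  simp [h]

open Finset in
theorem sum_card_missed_sq {α : Type*} [Fintype α] [DecidableEq α] (n : ℕ) :
    ∑ s : Fin n → α, (#{i | ∀ j, s j ≠ i} : ℝ) ^ 2
      = (Fintype.card α : ℝ) * ((Fintype.card α : ℝ) - 1) ^ n
        + (Fintype.card α : ℝ) * ((Fintype.card α : ℝ) - 1) * ((Fintype.card α : ℝ) - 2) ^ n := by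
  have hprod (s : Fin n → α) : (#{i | ∀ j, s j ≠ i} : ℝ) ^ 2
      = ∑ i : α, ∑ k : α, if ∀ j, s j ∉ ({i, k} : Finset α) then (1 : ℝ) else 0 := by
    rw [← sum_boole, sq, sum_mul_sum]
    refine sum_congr rfl fun i _ => sum_congr rfl fun k _ => ?_
    simp [← ite_and, forall_and, and_comm]
  have hpair (i k : α) : ((Fintype.card α : ℝ) - #({i, k} : Finset α)) ^ n
      = ((Fintype.card α : ℝ) - 2) ^ n
        + if i = k then ((Fintype.card α : ℝ) - 1) ^ n - ((Fintype.card α : ℝ) - 2) ^ n else 0 := by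
    by_cases h : i = k
    · simp [h]
    · simp [h]
  simp_rw [hprod]
  rw [sum_comm]
  simp_rw [sum_comm (s := (univ : Finset (Fin n → α))), sum_avoiding_indicator, hpair,
    sum_add_distrib, sum_ite_eq]
  simp only [mem_univ, if_true, sum_const, card_univ, nsmul_eq_mul]
  ring

open Finset in
/-- Chebyshev's inequality for the lower tail at half the mean, with respect to counting. -/
theorem card_le_half_mul_sq_le {Ω : Type*} [Fintype Ω] (U : Ω → ℝ) {m : ℝ} (hm : 0 ≤ m)
    [DecidablePred fun s => U s ≤ 1 / 2 * m] :
    (#{s | U s ≤ 1 / 2 * m} : ℝ) * (m / 2) ^ 2 ≤ ∑ s, (U s - m) ^ 2 := by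
  rw [← nsmul_eq_mul]
  refine (card_nsmul_le_sum _ (fun s => (U s - m) ^ 2) _ fun s hs => ?_).trans
    (sum_le_univ_sum_of_nonneg fun s => sq_nonneg _)
  have := (mem_filter.mp hs).2
  nlinarith

open Finset in
theorem sum_card_missed_sub_mean_sq_le {r : ℕ} (n : ℕ) (hr : 2 ≤ r) {m : ℝ}
    (hm : m = r * (1 - 1 / (r : ℝ)) ^ n) :
    ∑ s : Fin n → Fin r, ((#{i | ∀ j, s j ≠ i} : ℝ) - m) ^ 2 ≤ m * (r : ℝ) ^ n := by
  have hr' : (2 : ℝ) ≤ r := by exact_mod_cast hr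
  have hmean : (r : ℝ) * ((r : ℝ) - 1) ^ n = m * (r : ℝ) ^ n := by
    rw [hm, mul_assoc, ← mul_pow]
    congr 2
    field_simp
  have hpow : ((r : ℝ) - 2) ^ n * (r : ℝ) ^ n ≤ ((r : ℝ) - 1) ^ n * ((r : ℝ) - 1) ^ n := by
    rw [← mul_pow, ← mul_pow]
    exact pow_le_pow_left₀ (mul_nonneg (by linarith) (by linarith)) (by nlinarith) n
  have hpair : (r : ℝ) * ((r : ℝ) - 1) * ((r : ℝ) - 2) ^ n ≤ m ^ 2 * (r : ℝ) ^ n := by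
    have hpos : (0 : ℝ) < (r : ℝ) ^ n := by positivity
    refine le_of_mul_le_mul_right ?_ hpos
    calc (r : ℝ) * ((r : ℝ) - 1) * ((r : ℝ) - 2) ^ n * (r : ℝ) ^ n
        = (r : ℝ) * ((r : ℝ) - 1) * (((r : ℝ) - 2) ^ n * (r : ℝ) ^ n) := by ring
      _ ≤ (r : ℝ) * r * (((r : ℝ) - 1) ^ n * ((r : ℝ) - 1) ^ n) := by
        refine mul_le_mul (by nlinarith) hpow ?_ (by positivity)
        exact mul_nonneg (pow_nonneg (by linarith) n) hpos.le
      _ = ((r : ℝ) * ((r : ℝ) - 1) ^ n) ^ 2 := by ring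
      _ = m ^ 2 * (r : ℝ) ^ n * (r : ℝ) ^ n := by rw [hmean]; ring
  have hexpand : ∑ s : Fin n → Fin r, ((#{i | ∀ j, s j ≠ i} : ℝ) - m) ^ 2
      = ∑ s : Fin n → Fin r, (#{i | ∀ j, s j ≠ i} : ℝ) ^ 2
        - 2 * m * ∑ s : Fin n → Fin r, (#{i | ∀ j, s j ≠ i} : ℝ) + m ^ 2 * (r : ℝ) ^ n := by
    simp_rw [sub_sq, sum_add_distrib, sum_sub_distrib, mul_sum]
    simp [mul_comm, mul_assoc]
  rw [hexpand, sum_card_missed_sq, sum_card_missed, Fintype.card_fin, hmean]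
  linarith

/-- Chebyshev step of the coupon-collector lemma. For `r ≥ 3`, `n ≥ 1`
with `n ≤ (r² − 2r)/32`, and `U` the number of elements of `{1,…,r}` not appearing among
`n` i.i.d. uniform samples from `{1,…,r}` (formalized as the uniform distribution over
tuples `s : Fin n → Fin r`, so probabilities are normalized counts),
`Pr[U ≤ (1/2)·r·(1 − 1/r)^n] ≤ 4/(r·(1 − 1/r)^n) + 1/4`. -/
theorem unsampled_chebyshev (r n : ℕ) (hr : 3 ≤ r) (hn : 1 ≤ n)
    (hnr : (n : ℝ) ≤ ((r : ℝ) ^ 2 - 2 * (r : ℝ)) / 32) :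
    ((Finset.univ.filter (fun s : Fin n → Fin r =>
        ((Finset.univ.filter (fun i : Fin r => ∀ j, s j ≠ i)).card : ℝ)
          ≤ (1 / 2) * (r : ℝ) * (1 - 1 / (r : ℝ)) ^ n)).card : ℝ) / (r : ℝ) ^ n
      ≤ 4 / ((r : ℝ) * (1 - 1 / (r : ℝ)) ^ n) + 1 / 4 := by
  have hr' : (3 : ℝ) ≤ r := by exact_mod_cast hr
  have hq : 0 < 1 - 1 / (r : ℝ) := by
    rw [sub_pos, div_lt_one (by linarith)]
    linarith
  set m : ℝ := (r : ℝ) * (1 - 1 / (r : ℝ)) ^ n with hm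
  have hmpos : 0 < m := by positivity
  have hcheb := (card_le_half_mul_sq_le
    (fun s : Fin n → Fin r => ((Finset.univ.filter fun i => ∀ j, s j ≠ i).card : ℝ))
    hmpos.le).trans (sum_card_missed_sub_mean_sq_le n (by omega) hm)
  rw [mul_assoc (1 / 2 : ℝ), ← hm]
  refine le_trans ?_ (le_add_of_nonneg_right (by norm_num))
  rw [div_le_div_iff₀ (by positivity) hmpos]
  refine le_of_mul_le_mul_right ?_ hmpos
  linarith
end

section
/- Let r ≥ 3 and n ≥ 1 be integers. Let s_1,…,s_n be i.i.d. uniform samples from {1,…,r} and let U = |{i ∈ {1,…,r} : i ∉ {s_1,…,s_n}}|. Then E[ (U − r·(1 − 1/r)^n)² ] ≤ r·(1 − 1/r)^n + r²·(1 − 1/r)^{2n}·( exp( n/(r² − 2r) ) − 1 ). -/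
open Classical

section Avoidance

variable {ι α : Type*} [Fintype ι] [Fintype α] [DecidableEq ι] [DecidableEq α]

theorem card_filter_forall_notMem (A : Finset α) :
    (Finset.univ.filter (fun s : ι → α => ∀ j, s j ∉ A)).card =
      (Fintype.card α - A.card) ^ Fintype.card ι := by
  have h : Finset.univ.filter (fun s : ι → α => ∀ j, s j ∉ A) =
      Fintype.piFinset fun _ : ι => Aᶜ := by
    ext s
    simp [Fintype.mem_piFinset]
  simp [h, Fintype.card_piFinset, Finset.card_compl]

theorem sum_card_unsampled :
    ∑ s : ι → α, (Finset.univ.filter (fun i : α => ∀ j, s j ≠ i)).card =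
      Fintype.card α * (Fintype.card α - 1) ^ Fintype.card ι := by
  have avoid (i : α) : (Finset.univ.filter (fun s : ι → α => ∀ j, s j ≠ i)).card =
      (Fintype.card α - 1) ^ Fintype.card ι := by
    simpa using card_filter_forall_notMem (ι := ι) {i}
  simp_rw [Finset.card_filter]
  rw [Finset.sum_comm]
  simp_rw [← Finset.card_filter, avoid]
  simp

theorem sum_card_unsampled_sq :
    ∑ s : ι → α, (Finset.univ.filter (fun i : α => ∀ j, s j ≠ i)).card ^ 2 =
      Fintype.card α * (Fintype.card α - 1) ^ Fintype.card ι +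
        Fintype.card α * (Fintype.card α - 1) * (Fintype.card α - 2) ^ Fintype.card ι := by
  have avoid (i k : α) :
      ∑ s : ι → α, (if ∀ j, s j ≠ i then 1 else 0) * (if ∀ j, s j ≠ k then 1 else 0) =
        if i = k then (Fintype.card α - 1) ^ Fintype.card ι
          else (Fintype.card α - 2) ^ Fintype.card ι := by
    have key := card_filter_forall_notMem (ι := ι) {i, k}
    simp only [Finset.mem_insert, Finset.mem_singleton, not_or, forall_and,
      Finset.card_filter] at key
    simp only [ite_zero_mul_ite_zero, mul_one]
    refine key.trans ?_
    split_ifs with h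
    · simp [h]
    · rw [Finset.card_pair h]
  simp_rw [Finset.card_filter, sq, Finset.sum_mul_sum]
  rw [Finset.sum_comm]
  simp_rw [Finset.sum_comm (s := (Finset.univ : Finset (ι → α))), avoid]
  simp [Finset.sum_ite, Finset.filter_eq, Finset.filter_ne, mul_add, mul_assoc]

end Avoidance

/-- second-moment bound for the number `U` of unsampled elements among
`n` i.i.d. uniform draws from `{1,…,r}` (formalized as the uniform distribution over
tuples `s : Fin n → Fin r`, expectation being the normalized sum over all tuples):
`E[(U − r(1 − 1/r)^n)²] ≤ r(1 − 1/r)^n + r²(1 − 1/r)^{2n}·(exp(n/(r² − 2r)) − 1)`. -/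
theorem unsampled_second_moment (r n : ℕ) (hr : 3 ≤ r) (hn : 1 ≤ n) :
    (∑ s : Fin n → Fin r,
        (((Finset.univ.filter (fun i : Fin r => ∀ j, s j ≠ i)).card : ℝ)
          - (r : ℝ) * (1 - 1 / (r : ℝ)) ^ n) ^ 2) / (r : ℝ) ^ n
      ≤ (r : ℝ) * (1 - 1 / (r : ℝ)) ^ n
        + (r : ℝ) ^ 2 * (1 - 1 / (r : ℝ)) ^ (2 * n)
          * (Real.exp ((n : ℝ) / ((r : ℝ) ^ 2 - 2 * (r : ℝ))) - 1) := by
  have hr' : (3 : ℝ) ≤ r := by exact_mod_cast hr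
  have hr0 : (0 : ℝ) < r := by linarith
  have first : ∑ s : Fin n → Fin r,
      ((Finset.univ.filter (fun i : Fin r => ∀ j, s j ≠ i)).card : ℝ) =
        r * ((r : ℝ) - 1) ^ n := by
    have h := congrArg (Nat.cast (R := ℝ)) (sum_card_unsampled (ι := Fin n) (α := Fin r))
    simpa [Nat.cast_sub (show 1 ≤ r by omega)] using h
  have second : ∑ s : Fin n → Fin r,
      ((Finset.univ.filter (fun i : Fin r => ∀ j, s j ≠ i)).card : ℝ) ^ 2 =
        r * ((r : ℝ) - 1) ^ n + r * ((r : ℝ) - 1) * ((r : ℝ) - 2) ^ n := by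
    have h := congrArg (Nat.cast (R := ℝ)) (sum_card_unsampled_sq (ι := Fin n) (α := Fin r))
    simpa [Nat.cast_sub (show 1 ≤ r by omega), Nat.cast_sub (show 2 ≤ r by omega)] using h
  have variance_eq : (∑ s : Fin n → Fin r,
      (((Finset.univ.filter (fun i : Fin r => ∀ j, s j ≠ i)).card : ℝ)
        - (r : ℝ) * (1 - 1 / (r : ℝ)) ^ n) ^ 2) / (r : ℝ) ^ n =
      r * (1 - 1 / (r : ℝ)) ^ n + r * ((r : ℝ) - 1) * (1 - 2 / (r : ℝ)) ^ n
        - (r : ℝ) ^ 2 * (1 - 1 / (r : ℝ)) ^ (2 * n) := by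
    simp_rw [sub_sq, Finset.sum_add_distrib, Finset.sum_sub_distrib, ← Finset.sum_mul,
      ← Finset.mul_sum, first, second]
    have h₁ : ((r : ℝ) - 1) ^ n = r ^ n * (1 - 1 / (r : ℝ)) ^ n := by
      rw [← mul_pow]; congr 1; field_simp
    have h₂ : ((r : ℝ) - 2) ^ n = r ^ n * (1 - 2 / (r : ℝ)) ^ n := by
      rw [← mul_pow]; congr 1; field_simp
    rw [h₁, h₂, div_eq_iff (by positivity)]
    simp only [Finset.sum_const, Finset.card_univ, Fintype.card_pi, Fintype.card_fin,
      Finset.prod_const, nsmul_eq_mul, Nat.cast_pow]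
    ring
  have pair_le : (1 - 2 / (r : ℝ)) ^ n ≤ (1 - 1 / (r : ℝ)) ^ (2 * n) := by
    rw [pow_mul]
    refine pow_le_pow_left₀ ?_ ?_ n
    · rw [sub_nonneg, div_le_one hr0]; linarith
    · have h : (1 - 1 / (r : ℝ)) ^ 2 = 1 - 2 / r + (1 / (r : ℝ)) ^ 2 := by ring
      rw [h]
      exact le_add_of_nonneg_right (sq_nonneg _)
  have exp_ge : 1 ≤ Real.exp ((n : ℝ) / ((r : ℝ) ^ 2 - 2 * (r : ℝ))) :=
    Real.one_le_exp (div_nonneg n.cast_nonneg (by nlinarith))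
  have pow_nonneg' : 0 ≤ (1 - 1 / (r : ℝ)) ^ (2 * n) := (even_two_mul n).pow_nonneg _
  have bound : (r : ℝ) * ((r : ℝ) - 1) * (1 - 2 / (r : ℝ)) ^ n ≤
      (r : ℝ) ^ 2 * (1 - 1 / (r : ℝ)) ^ (2 * n) :=
    (mul_le_mul_of_nonneg_left pair_le (by nlinarith)).trans
      (mul_le_mul_of_nonneg_right (by nlinarith) pow_nonneg')
  have slack : 0 ≤ (r : ℝ) ^ 2 * (1 - 1 / (r : ℝ)) ^ (2 * n)
      * (Real.exp ((n : ℝ) / ((r : ℝ) ^ 2 - 2 * (r : ℝ))) - 1) :=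
    mul_nonneg (by positivity) (sub_nonneg.2 exp_ge)
  rw [variance_eq]
  linarith
end
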